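/- Let ξ := sup{ x ≥ 0 : α*(x) = 0 }. Then ξ is finite and α*(x) = x − ξ for all x ≥ ξ. -/

import Mathlib

open MeasureTheory Set Filter Topology

noncomputable section

/-- The constant `b̄ = β ∫ z⁺ ν(dz) / (1-β)`. -/
def bbar (ν : Measure ℝ) (β : ℝ) : ℝ := β * (∫ z, max z 0 ∂ν) / (1 - β)

/-- The dynamic programming operator `T`. -/
def Tdiv (ν : Measure ℝ) (β γ : ℝ) (v : ℝ → ℝ) (x : ℝ) : ℝ :=
  if 0 ≤ x then
    sSup ((fun a => a - (β / γ) * Real.log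
      ((∫ z in Ici (a - x), Real.exp (-(γ * v (x - a + z))) ∂ν)
        + (ν (Iio (a - x))).toReal)) '' Icc 0 x)
  else 0

/-- Membership in the set `S₀`. -/
def memS0 (ν : Measure ℝ) (β : ℝ) (v : ℝ → ℝ) : Prop :=
  (∀ x, 0 ≤ v x) ∧ (∀ x, 0 ≤ x → v x ≤ x + bbar ν β) ∧ (∀ x, x < 0 → v x = 0)
    ∧ MonotoneOn v (Ici 0) ∧ ContinuousOn v (Ici 0)

/-- Membership in the set `S`. -/
def memS (ν : Measure ℝ) (β : ℝ) (v : ℝ → ℝ) : Prop :=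
  (∀ x, 0 ≤ v x) ∧ (∀ x, 0 ≤ x → x ≤ v x ∧ v x ≤ x + bbar ν β) ∧ (∀ x, x < 0 → v x = 0)
    ∧ MonotoneOn v (Ici 0) ∧ ContinuousOn v (Ici 0)

/-- A decision rule. -/
def DecisionRule (α : ℝ → ℝ) : Prop :=
  Measurable α ∧ (∀ x, 0 ≤ x → α x ∈ Icc 0 x) ∧ (∀ x, x < 0 → α x = 0)

/-- The operator `L_α` associated with a decision rule `α`. -/
def Ldiv (ν : Measure ℝ) (β γ : ℝ) (α : ℝ → ℝ) (v : ℝ → ℝ) (x : ℝ) : ℝ :=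
  if 0 ≤ x then
    α x - (β / γ) * Real.log
      ((∫ z in Ici (α x - x), Real.exp (-(γ * v (x - α x + z))) ∂ν)
        + (ν (Iio (α x - x))).toReal)
  else 0

/-- The function `Γ` associated with a value function `J`. -/
def Gam (ν : Measure ℝ) (β γ : ℝ) (J : ℝ → ℝ) (x : ℝ) : ℝ :=
  -(β / γ) * Real.log
    ((∫ z in Ici (-x), Real.exp (-(γ * J (x + z))) ∂ν) + (ν (Iio (-x))).toReal)

end

/-- Functions in `S` are monotone on the whole line. -/
lemma memS.monotone {ν : Measure ℝ} {β : ℝ} {v : ℝ → ℝ} (hv : memS ν β v) : Monotone v := by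
  obtain ⟨h0, -, hz, hm, -⟩ := hv
  intro x y hxy
  rcases lt_or_ge x 0 with hx | hx
  · rw [hz x hx]
    exact h0 y
  · exact hm hx (hx.trans hxy) hxy

lemma bbar_nonneg (ν : Measure ℝ) {β : ℝ} (hβ : β ∈ Ioo (0 : ℝ) 1) : 0 ≤ bbar ν β := by
  have h : 0 ≤ ∫ z, max z 0 ∂ν := integral_nonneg fun z => le_max_right z 0
  exact div_nonneg (mul_nonneg hβ.1.le h) (sub_nonneg.2 hβ.2.le)

/-- Jensen's inequality for the exponential: `-∫ u ≤ log ∫ exp (-u)`. -/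
lemma neg_integral_le_log_integral_exp_neg {Ω : Type*} [MeasurableSpace Ω] {μ : Measure Ω}
    [IsProbabilityMeasure μ] {u : Ω → ℝ} (hu : Integrable u μ)
    (hexp : Integrable (fun z => Real.exp (-u z)) μ) :
    -∫ z, u z ∂μ ≤ Real.log (∫ z, Real.exp (-u z) ∂μ) := by
  have h := convexOn_exp.map_integral_le Real.continuous_exp.continuousOn isClosed_univ
    (Filter.Eventually.of_forall fun _ => mem_univ _) hu.neg hexp
  have h' : Real.exp (-∫ z, u z ∂μ) ≤ ∫ z, Real.exp (-u z) ∂μ := by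
    simpa [integral_neg] using h
  exact (Real.le_log_iff_exp_le ((Real.exp_pos _).trans_le h')).2 h'

lemma setIntegral_Ici_add_measure_Iio_eq_integral (ν : Measure ℝ) [IsProbabilityMeasure ν]
    {γ x : ℝ} {v : ℝ → ℝ} (hz : ∀ y, y < 0 → v y = 0)
    (hi : Integrable (fun z => Real.exp (-(γ * v (x + z)))) ν) :
    (∫ z in Ici (-x), Real.exp (-(γ * v (x + z))) ∂ν) + (ν (Iio (-x))).toReal
      = ∫ z, Real.exp (-(γ * v (x + z))) ∂ν := by
  have h1 : ∫ z in Iio (-x), Real.exp (-(γ * v (x + z))) ∂ν = (ν (Iio (-x))).toReal := by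
    rw [setIntegral_congr_fun (g := fun _ => (1 : ℝ)) measurableSet_Iio]
    · simp [Measure.real]
    · intro z hzx
      have : x + z < 0 := by linarith [mem_Iio.1 hzx]
      simp [hz _ this]
  rw [← h1, ← compl_Ici, integral_add_compl measurableSet_Ici hi]

/-- The linear growth bound `Γ(x) ≤ β x + b̄`. -/
lemma Gam_le (ν : Measure ℝ) [IsProbabilityMeasure ν]
    (hint : Integrable (fun z => max z 0) ν) {β γ : ℝ} (hβ : β ∈ Ioo (0 : ℝ) 1) (hγ : 0 < γ)
    {v : ℝ → ℝ} (hv : memS ν β v) {x : ℝ} (hx : 0 ≤ x) :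
    Gam ν β γ v x ≤ β * x + bbar ν β := by
  have hb := bbar_nonneg ν hβ
  have hmono := hv.monotone
  have integrable_exp : ∀ w : ℝ → ℝ, Measurable w → (∀ z, 0 ≤ w z) →
      Integrable (fun z => Real.exp (-(γ * w z))) ν := by
    intro w hw hw0
    refine Integrable.of_bound (C := 1) (by fun_prop) (Filter.Eventually.of_forall fun z => ?_)
    rw [Real.norm_eq_abs, Real.abs_exp, Real.exp_le_one_iff]
    nlinarith [mul_nonneg hγ.le (hw0 z)]
  have hvi : Integrable (fun z => Real.exp (-(γ * v (x + z)))) ν :=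
    integrable_exp (fun z => v (x + z)) (hmono.measurable.comp (measurable_const_add x))
      fun z => hv.1 _
  let u : ℝ → ℝ := fun z => x + bbar ν β + max z 0
  have hu_int : Integrable u ν := (integrable_const _).add hint
  have hui : Integrable (fun z => Real.exp (-(γ * u z))) ν :=
    integrable_exp u (by fun_prop) fun z => by
      have := le_max_right z 0
      positivity
  have hle : ∀ z, v (x + z) ≤ u z := by
    intro z
    have h1 := le_max_left z 0
    have h2 := le_max_right z 0
    rcases lt_or_ge (x + z) 0 with h | h
    · rw [hv.2.2.1 _ h]
      positivity
    · have := (hv.2.1 _ h).2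
      simp only [u]
      linarith
  have hcmp : ∫ z, Real.exp (-(γ * u z)) ∂ν ≤ ∫ z, Real.exp (-(γ * v (x + z))) ∂ν :=
    integral_mono hui hvi fun z =>
      Real.exp_le_exp.2 (neg_le_neg (mul_le_mul_of_nonneg_left (hle z) hγ.le))
  have hlog := (neg_integral_le_log_integral_exp_neg (hu_int.const_mul γ) hui).trans
    (Real.log_le_log (integral_exp_pos hui) hcmp)
  have hu_eq : ∫ z, u z ∂ν = x + bbar ν β + ∫ z, max z 0 ∂ν := by
    simp only [u]
    rw [integral_add (integrable_const _) hint]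
    simp
  rw [integral_const_mul, hu_eq] at hlog
  rw [Gam, setIntegral_Ici_add_measure_Iio_eq_integral ν hv.2.2.1 hvi]
  have hbb : bbar ν β * (1 - β) = β * ∫ z, max z 0 ∂ν :=
    div_mul_cancel₀ _ (sub_pos.2 hβ.2).ne'
  have hscaled := mul_le_mul_of_nonneg_left hlog (div_pos hβ.1 hγ).le
  have hcancel : β / γ * -(γ * (x + bbar ν β + ∫ z, max z 0 ∂ν))
      = -(β * (x + bbar ν β + ∫ z, max z 0 ∂ν)) := by
    field_simp
  rw [hcancel] at hscaled
  linarith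

/-- The fixed point dominates the value of every admissible action. -/
lemma add_Gam_le_of_fixedPoint (ν : Measure ℝ) [IsProbabilityMeasure ν]
    (hint : Integrable (fun z => max z 0) ν) {β γ : ℝ} (hβ : β ∈ Ioo (0 : ℝ) 1) (hγ : 0 < γ)
    {J : ℝ → ℝ} (hJ : memS ν β J) (hfix : Tdiv ν β γ J = J) {x a : ℝ} (ha : a ∈ Icc 0 x) :
    a + Gam ν β γ J (x - a) ≤ J x := by
  have hT : J x = sSup ((fun a => a + Gam ν β γ J (x - a)) '' Icc 0 x) := by
    conv_lhs => rw [← hfix, Tdiv, if_pos (ha.1.trans ha.2)]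
    simp only [Gam, neg_sub, neg_mul, sub_eq_add_neg _ (_ * _)]
  rw [hT]
  refine le_csSup ⟨x + β * x + bbar ν β, ?_⟩ (mem_image_of_mem _ ha)
  rintro _ ⟨b, hb, rfl⟩
  have h := Gam_le ν hint hβ hγ hJ (sub_nonneg.2 hb.2)
  have h2 := mul_nonneg hβ.1.le hb.1
  have h3 := hb.2
  simp only
  linarith

/-- with `ξ := sup{x ≥ 0 : α*(x) = 0}`, `ξ` is finite and
`α*(x) = x - ξ` for all `x ≥ ξ`. -/
theorem band_top_level (ν : Measure ℝ) [IsProbabilityMeasure ν]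
    (hac : ν ≪ volume) (hint : Integrable (fun z => max z 0) ν)
    (hneg : 0 < ν (Iio 0)) (β γ : ℝ) (hβ : β ∈ Ioo (0:ℝ) 1) (hγ : 0 < γ)
    (J : ℝ → ℝ) (hJ : memS ν β J) (hfix : Tdiv ν β γ J = J)
    (αs : ℝ → ℝ)
    (hαs : ∀ x : ℝ, 0 ≤ x →
      IsGreatest {a | a ∈ Icc 0 x ∧ a + Gam ν β γ J (x - a) = J x} (αs x)) :
    BddAbove {x : ℝ | 0 ≤ x ∧ αs x = 0} ∧
    ∀ x : ℝ, sSup {x : ℝ | 0 ≤ x ∧ αs x = 0} ≤ x →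
      αs x = x - sSup {x : ℝ | 0 ≤ x ∧ αs x = 0} := by
  have hdom : ∀ x a, a ∈ Icc 0 x → a + Gam ν β γ J (x - a) ≤ J x := fun x a ha =>
    add_Gam_le_of_fixedPoint ν hint hβ hγ hJ hfix ha
  have hrecord : ∀ r, 0 ≤ r → αs r = 0 → ∀ y, 0 ≤ y → y < r →
      Gam ν β γ J y - y < Gam ν β γ J r - r := by
    intro r hr hr0 y hy hyr
    obtain ⟨⟨-, heq⟩, hmax⟩ := hαs r hr
    rw [hr0, sub_zero, zero_add] at heq
    have hmem : r - y ∈ Icc 0 r := ⟨by linarith, by linarith⟩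
    have hle := hdom r (r - y) hmem
    by_contra! hcon
    have hup := hmax ⟨hmem, le_antisymm hle (by rw [sub_sub_cancel]; linarith)⟩
    linarith
  have hbdd : BddAbove {x : ℝ | 0 ≤ x ∧ αs x = 0} := by
    refine ⟨bbar ν β / (1 - β), ?_⟩
    rintro r ⟨hr, hr0⟩
    have hb := bbar_nonneg ν hβ
    have hβ' := sub_pos.2 hβ.2
    rcases hr.eq_or_lt with rfl | hpos
    · positivity
    · have hlt := hrecord r hr hr0 0 le_rfl hpos
      have hJ0 : 0 ≤ Gam ν β γ J 0 := by
        obtain ⟨⟨hmem, heq⟩, -⟩ := hαs 0 le_rfl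
        rw [le_antisymm hmem.2 hmem.1, sub_zero, zero_add] at heq
        rw [heq]
        exact hJ.1 0
      have hG := Gam_le ν hint hβ hγ hJ hr
      rw [le_div_iff₀ hβ']
      linarith
  have hzero : (0 : ℝ) ∈ {x : ℝ | 0 ≤ x ∧ αs x = 0} :=
    ⟨le_rfl, le_antisymm (hαs 0 le_rfl).1.1.2 (hαs 0 le_rfl).1.1.1⟩
  refine ⟨hbdd, fun x hx => ?_⟩
  have hx0 : 0 ≤ x := (le_csSup hbdd hzero).trans hx
  obtain ⟨⟨hmem, heq⟩, hmax⟩ := hαs x hx0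
  have hy0 : 0 ≤ x - αs x := sub_nonneg.2 hmem.2
  have hy : αs (x - αs x) = 0 := by
    obtain ⟨⟨hbmem, hbeq⟩, -⟩ := hαs (x - αs x) hy0
    have hge := hdom (x - αs x) 0 ⟨le_rfl, hy0⟩
    rw [sub_zero, zero_add] at hge
    have hsum : αs x + αs (x - αs x) ∈ Icc 0 x :=
      ⟨add_nonneg hmem.1 hbmem.1, by linarith [hbmem.2]⟩
    have hle := hdom x _ hsum
    have hup := hmax ⟨hsum, le_antisymm hle (by rw [← sub_sub]; linarith)⟩
    exact le_antisymm (by linarith) hbmem.1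
  have hle : x - αs x ≤ sSup {x : ℝ | 0 ≤ x ∧ αs x = 0} := le_csSup hbdd ⟨hy0, hy⟩
  have hge : sSup {x : ℝ | 0 ≤ x ∧ αs x = 0} ≤ x - αs x := by
    by_contra! hlt
    obtain ⟨r, hr, hyr⟩ := exists_lt_of_lt_csSup ⟨0, hzero⟩ hlt
    have hrx := (le_csSup hbdd hr).trans hx
    have hrec := hrecord r hr.1 hr.2 _ hy0 hyr
    have hd := hdom x (x - r) ⟨sub_nonneg.2 hrx, by linarith [hr.1]⟩
    rw [sub_sub_cancel] at hd
    linarith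
  linarith
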